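/- There exists a nonzero rational number c such that, in the polynomial ring Q[a, b, w0, w1, w2, w3, w4], the identity sum over i in Z/5Z of ( 5*a^3*b^3*p_i^2 + a*(a^5 - 3*b^5)*p_{i+1}*p_{i+4} - b*(3*a^5 + b^5)*p_{i+2}*p_{i+3} ) * w_i = c * det(J) holds. -/

import Mathlib

open MvPolynomial

/-- The polynomial ring `ℚ[a, b, w₀, w₁, w₂, w₃, w₄]`, with the `w` variables
indexed by `ℤ/5ℤ`. -/
abbrev R5 : Type := MvPolynomial (Fin 2 ⊕ ZMod 5) ℚ

/-- The variable `a`. -/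
noncomputable def va : R5 := X (Sum.inl 0)

/-- The variable `b`. -/
noncomputable def vb : R5 := X (Sum.inl 1)

/-- The variable `w_i`, `i ∈ ℤ/5ℤ`. -/
noncomputable def vw (i : ZMod 5) : R5 := X (Sum.inr i)

/-- The quadratic form `p_i = a b w_i² + b² w_{i-1} w_{i+1} - a² w_{i-2} w_{i+2}`. -/
noncomputable def pq (i : ZMod 5) : R5 :=
  va * vb * vw i ^ 2 + vb ^ 2 * vw (i - 1) * vw (i + 1) - va ^ 2 * vw (i - 2) * vw (i + 2)

/-- The Jacobian matrix `J = (∂p_i/∂w_j)`. -/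
noncomputable def Jmat : Matrix (ZMod 5) (ZMod 5) R5 :=
  Matrix.of fun i j => pderiv (Sum.inr j) (pq i)

/-- The Jacobian matrix, written out explicitly. -/
def explicitJ {R : Type*} [CommRing R] (a b w0 w1 w2 w3 w4 : R) : Matrix (Fin 5) (Fin 5) R :=
  !![2 * a * b * w0, b ^ 2 * w4, -(a ^ 2 * w3), -(a ^ 2 * w2), b ^ 2 * w1;
    b ^ 2 * w2, 2 * a * b * w1, b ^ 2 * w0, -(a ^ 2 * w4), -(a ^ 2 * w3);
    -(a ^ 2 * w4), b ^ 2 * w3, 2 * a * b * w2, b ^ 2 * w1, -(a ^ 2 * w0);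
    -(a ^ 2 * w1), -(a ^ 2 * w0), b ^ 2 * w4, 2 * a * b * w3, b ^ 2 * w2;
    b ^ 2 * w3, -(a ^ 2 * w2), -(a ^ 2 * w1), b ^ 2 * w0, 2 * a * b * w4]

set_option maxHeartbeats 4000000 in
theorem generic_identity {R : Type*} [CommRing R] (a b w0 w1 w2 w3 w4 p0 p1 p2 p3 p4 : R)
    (h0 : p0 = a * b * w0 ^ 2 + b ^ 2 * w4 * w1 - a ^ 2 * w3 * w2)
    (h1 : p1 = a * b * w1 ^ 2 + b ^ 2 * w0 * w2 - a ^ 2 * w4 * w3)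
    (h2 : p2 = a * b * w2 ^ 2 + b ^ 2 * w1 * w3 - a ^ 2 * w0 * w4)
    (h3 : p3 = a * b * w3 ^ 2 + b ^ 2 * w2 * w4 - a ^ 2 * w1 * w0)
    (h4 : p4 = a * b * w4 ^ 2 + b ^ 2 * w3 * w0 - a ^ 2 * w2 * w1) :
    2 * ((5 * a ^ 3 * b ^ 3 * p0 ^ 2 + a * (a ^ 5 - 3 * b ^ 5) * p1 * p4
      - b * (3 * a ^ 5 + b ^ 5) * p2 * p3) * w0 +
    (5 * a ^ 3 * b ^ 3 * p1 ^ 2 + a * (a ^ 5 - 3 * b ^ 5) * p2 * p0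
      - b * (3 * a ^ 5 + b ^ 5) * p3 * p4) * w1 +
    (5 * a ^ 3 * b ^ 3 * p2 ^ 2 + a * (a ^ 5 - 3 * b ^ 5) * p3 * p1
      - b * (3 * a ^ 5 + b ^ 5) * p4 * p0) * w2 +
    (5 * a ^ 3 * b ^ 3 * p3 ^ 2 + a * (a ^ 5 - 3 * b ^ 5) * p4 * p2
      - b * (3 * a ^ 5 + b ^ 5) * p0 * p1) * w3 +
    (5 * a ^ 3 * b ^ 3 * p4 ^ 2 + a * (a ^ 5 - 3 * b ^ 5) * p0 * p3
      - b * (3 * a ^ 5 + b ^ 5) * p1 * p2) * w4) = -5 * (explicitJ a b w0 w1 w2 w3 w4).det := by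
  subst h0 h1 h2 h3 h4
  simp only [explicitJ, Matrix.det_succ_row_zero, Fin.sum_univ_succ]
  simp [Fin.succAbove, Fin.lt_def]
  ring

theorem pderiv_pq (i j : ZMod 5) : pderiv (Sum.inr j) (pq i) =
    2 * va * vb * vw i * (if i = j then 1 else 0)
    + vb ^ 2 * (vw (i - 1) * (if i + 1 = j then 1 else 0) + vw (i + 1) * (if i - 1 = j then 1 else 0))
    - va ^ 2 * (vw (i - 2) * (if i + 2 = j then 1 else 0) + vw (i + 2) * (if i - 2 = j then 1 else 0)) := by
  have hw (k : ZMod 5) : pderiv (Sum.inr j) (vw k) = if k = j then 1 else 0 := by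
    simp [vw, pderiv_X, Pi.single_apply]
  have ha : pderiv (Sum.inr j) va = 0 := by simp [va, pderiv_X]
  have hb : pderiv (Sum.inr j) vb = 0 := by simp [vb, pderiv_X]
  simp only [pq, map_add, map_sub, Derivation.leibniz, Derivation.leibniz_pow, hw, ha, hb,
    smul_eq_mul, nsmul_eq_mul]
  push_cast
  ring

theorem pderiv_pq0 (i : ZMod 5) : pderiv (Sum.inr i) (pq i) = 2 * va * vb * vw i := by
  rw [pderiv_pq]
  rw [if_neg (show ¬ (i + 1 = i) by revert i; decide)]
  rw [if_neg (show ¬ (i - 1 = i) by revert i; decide)]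
  rw [if_neg (show ¬ (i + 2 = i) by revert i; decide)]
  rw [if_neg (show ¬ (i - 2 = i) by revert i; decide)]
  rw [if_pos rfl]
  ring

theorem pderiv_pq1 (i : ZMod 5) : pderiv (Sum.inr (i + 1)) (pq i) = vb ^ 2 * vw (i - 1) := by
  rw [pderiv_pq]
  rw [if_neg (show ¬ (i = i + 1) by revert i; decide)]
  rw [if_neg (show ¬ (i - 1 = i + 1) by revert i; decide)]
  rw [if_neg (show ¬ (i + 2 = i + 1) by revert i; decide)]
  rw [if_neg (show ¬ (i - 2 = i + 1) by revert i; decide)]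
  rw [if_pos rfl]
  ring

theorem pderiv_pq2 (i : ZMod 5) : pderiv (Sum.inr (i + 2)) (pq i) = -(va ^ 2 * vw (i - 2)) := by
  rw [pderiv_pq]
  rw [if_neg (show ¬ (i = i + 2) by revert i; decide)]
  rw [if_neg (show ¬ (i + 1 = i + 2) by revert i; decide)]
  rw [if_neg (show ¬ (i - 1 = i + 2) by revert i; decide)]
  rw [if_neg (show ¬ (i - 2 = i + 2) by revert i; decide)]
  rw [if_pos rfl]
  ring

theorem pderiv_pq3 (i : ZMod 5) : pderiv (Sum.inr (i - 2)) (pq i) = -(va ^ 2 * vw (i + 2)) := by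
  rw [pderiv_pq]
  rw [if_neg (show ¬ (i = i - 2) by revert i; decide)]
  rw [if_neg (show ¬ (i + 1 = i - 2) by revert i; decide)]
  rw [if_neg (show ¬ (i - 1 = i - 2) by revert i; decide)]
  rw [if_neg (show ¬ (i + 2 = i - 2) by revert i; decide)]
  rw [if_pos rfl]
  ring

theorem pderiv_pq4 (i : ZMod 5) : pderiv (Sum.inr (i - 1)) (pq i) = vb ^ 2 * vw (i + 1) := by
  rw [pderiv_pq]
  rw [if_neg (show ¬ (i = i - 1) by revert i; decide)]
  rw [if_neg (show ¬ (i + 1 = i - 1) by revert i; decide)]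
  rw [if_neg (show ¬ (i + 2 = i - 1) by revert i; decide)]
  rw [if_neg (show ¬ (i - 2 = i - 1) by revert i; decide)]
  rw [if_pos rfl]
  ring

theorem Jmat_eq : Jmat = explicitJ va vb (vw 0) (vw 1) (vw 2) (vw 3) (vw 4) := by
  have key (i j : Fin 5) : Jmat i j = explicitJ va vb (vw 0) (vw 1) (vw 2) (vw 3) (vw 4) i j := by
    fin_cases i <;> fin_cases j
    · exact pderiv_pq0 0
    · exact pderiv_pq1 0
    · exact pderiv_pq2 0
    · exact pderiv_pq3 0
    · exact pderiv_pq4 0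
    · exact pderiv_pq4 1
    · exact pderiv_pq0 1
    · exact pderiv_pq1 1
    · exact pderiv_pq2 1
    · exact pderiv_pq3 1
    · exact pderiv_pq3 2
    · exact pderiv_pq4 2
    · exact pderiv_pq0 2
    · exact pderiv_pq1 2
    · exact pderiv_pq2 2
    · exact pderiv_pq2 3
    · exact pderiv_pq3 3
    · exact pderiv_pq4 3
    · exact pderiv_pq0 3
    · exact pderiv_pq1 3
    · exact pderiv_pq1 4
    · exact pderiv_pq2 4
    · exact pderiv_pq3 4
    · exact pderiv_pq4 4
    · exact pderiv_pq0 4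
  exact funext fun i => funext fun j => key i j

/-- There is a nonzero rational constant `c` with
`∑_i (5a³b³ p_i² + a(a⁵-3b⁵) p_{i+1}p_{i+4} - b(3a⁵+b⁵) p_{i+2}p_{i+3}) w_i = c · det J`. -/
theorem Q6_of_P2_eq_det_J :
    ∃ c : ℚ, c ≠ 0 ∧
      (∑ i : ZMod 5,
        (5 * va ^ 3 * vb ^ 3 * pq i ^ 2
          + va * (va ^ 5 - 3 * vb ^ 5) * pq (i + 1) * pq (i + 4)
          - vb * (3 * va ^ 5 + vb ^ 5) * pq (i + 2) * pq (i + 3)) * vw i) =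
      C c * Jmat.det := by
  refine ⟨-5 / 2, by norm_num, ?_⟩
  have h := generic_identity va vb (vw 0) (vw 1) (vw 2) (vw 3) (vw 4)
    (pq 0) (pq 1) (pq 2) (pq 3) (pq 4) rfl rfl rfl rfl rfl
  have hJ : Jmat.det = (explicitJ va vb (vw 0) (vw 1) (vw 2) (vw 3) (vw 4)).det := by
    rw [Jmat_eq]; rfl
  rw [hJ]
  have hs (f : ZMod 5 → R5) : ∑ i : ZMod 5, f i = f 0 + f 1 + f 2 + f 3 + f 4 :=
    Fin.sum_univ_five f
  have hC : (2 : R5) * C (-5 / 2 : ℚ) = -5 := by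
    have e2 : (C (2 : ℚ) : R5) = 2 := map_ofNat C 2
    have e5 : (C (5 : ℚ) : R5) = 5 := map_ofNat C 5
    rw [← e2, ← e5, ← C_mul, ← C_neg]
    norm_num
  have h2 : (2 : R5) ≠ 0 := two_ne_zero
  apply mul_left_cancel₀ h2
  rw [← mul_assoc, hC, ← h, hs]
  rfl
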